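/- Let G be a hyperbolic group with finite generating set A, let d ∈ V^A(p,γ,T) be a visual metric on G, and let x ∈ G. Then the inner automorphism λ_x : g ↦ x⁻¹gx satisfies a Lipschitz condition as a map from (G,d) to (G,d): there exists K > 0 such that d(x⁻¹gx, x⁻¹hx) ≤ K·d(g,h) for all g,h ∈ G. -/

import Mathlib

open scoped Classical

section Defs

variable {G : Type*}

/-- Word length of `g` with respect to a generating set `A`: the least `n` such that
`g` is a product of `n` elements of `A ∪ A⁻¹`. -/
noncomputable def wordLength [Group G] (A : Set G) (g : G) : ℕ :=
  sInf {n : ℕ | ∃ w : List G, w.length = n ∧ (∀ x ∈ w, x ∈ A ∨ x⁻¹ ∈ A) ∧ w.prod = g}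

/-- The word metric `d_A(g,h)` (as a real number). -/
noncomputable def wordDist [Group G] (A : Set G) (g h : G) : ℝ :=
  (wordLength A (g⁻¹ * h) : ℝ)

/-- The Gromov product `(x|y)_p` with respect to a distance function `d`. -/
noncomputable def gromov {X : Type*} (d : X → X → ℝ) (p x y : X) : ℝ :=
  (d p x + d p y - d x y) / 2

/-- `G` is `δ`-hyperbolic with respect to the generating set `A`. -/
def IsHyperbolicWith [Group G] (A : Set G) (δ : ℝ) : Prop :=
  ∀ p g₀ g₁ g₂ : G,
    min (gromov (wordDist A) p g₀ g₁) (gromov (wordDist A) p g₁ g₂) - δ ≤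
      gromov (wordDist A) p g₀ g₂

/-- `G` is hyperbolic with respect to the generating set `A`. -/
def IsHyperbolic [Group G] (A : Set G) : Prop :=
  ∃ δ : ℝ, 0 ≤ δ ∧ IsHyperbolicWith A δ

/-- `ρ_{p,γ}(g,h) = e^{-γ (g|h)_p}` (and `0` on the diagonal), with respect to a
distance function `dA`. -/
noncomputable def visualRhoOf {X : Type*} (dA : X → X → ℝ) (p : X) (γ : ℝ) (g h : X) : ℝ :=
  if g = h then 0 else Real.exp (-γ * gromov dA p g h)

/-- `d` is a metric on `X`. -/
structure IsMetric {X : Type*} (d : X → X → ℝ) : Prop where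
  refl : ∀ x, d x x = 0
  eq_of : ∀ x y, d x y = 0 → x = y
  symm : ∀ x y, d x y = d y x
  triangle : ∀ x y z, d x z ≤ d x y + d y z

/-- `d` is a visual metric in `V(p,γ,T)` with respect to the distance function `dA`. -/
def InVisualOf {X : Type*} (dA : X → X → ℝ) (p : X) (γ T : ℝ) (d : X → X → ℝ) : Prop :=
  IsMetric d ∧ ∀ g h : X, g ≠ h →
    visualRhoOf dA p γ g h / T ≤ d g h ∧ d g h ≤ T * visualRhoOf dA p γ g h

/-- `d ∈ V^A(p,γ,T)`: `d` is a visual metric with respect to the word metric `d_A`. -/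
def InVisual [Group G] (A : Set G) (p : G) (γ T : ℝ) (d : G → G → ℝ) : Prop :=
  InVisualOf (wordDist A) p γ T d

/-- `φ : (X,d) → (X,d')` satisfies a Hölder condition of exponent `r`. -/
def HolderCondWith {X : Type*} (d d' : X → X → ℝ) (φ : X → X) (r : ℝ) : Prop :=
  ∃ K : ℝ, 0 < K ∧ ∀ g h : X, d' (φ g) (φ h) ≤ K * d g h ^ r

/-- `φ : (X,d) → (X,d')` satisfies a Hölder condition (of some positive exponent). -/
def SatisfiesHolder {X : Type*} (d d' : X → X → ℝ) (φ : X → X) : Prop :=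
  ∃ r : ℝ, 0 < r ∧ HolderCondWith d d' φ r

/-- `φ : (X,d) → (X,d')` satisfies a Lipschitz condition. -/
def LipschitzCond {X : Type*} (d d' : X → X → ℝ) (φ : X → X) : Prop :=
  ∃ K : ℝ, 0 < K ∧ ∀ g h : X, d' (φ g) (φ h) ≤ K * d g h

/-- `φ : (X,d) → (X,d')` is uniformly continuous. -/
def UnifCont {X : Type*} (d d' : X → X → ℝ) (φ : X → X) : Prop :=
  ∀ ε : ℝ, 0 < ε → ∃ δ : ℝ, 0 < δ ∧ ∀ g h : X, d g h < δ → d' (φ g) (φ h) < ε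

/-- `φ : (X,d) → (X,d')` is a quasi-isometric embedding. -/
def QIEmbedding {X : Type*} (d d' : X → X → ℝ) (φ : X → X) : Prop :=
  ∃ lam K : ℝ, 1 ≤ lam ∧ 0 ≤ K ∧ ∀ g h : X,
    (1 / lam) * d g h - K ≤ d' (φ g) (φ h) ∧ d' (φ g) (φ h) ≤ lam * d g h + K

/-- `H` is a quasiconvex subset of `G` with respect to the generating set `A`:
every geodesic word-metric chain joining two points of `H` stays at bounded
distance from `H`. -/
def IsQuasiconvex [Group G] (A : Set G) (H : Set G) : Prop :=
  ∃ q : ℝ, 0 ≤ q ∧ ∀ h ∈ H, ∀ h' ∈ H, ∀ n : ℕ, ∀ g : ℕ → G,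
    g 0 = h → g n = h' → (n : ℝ) = wordDist A h h' →
    (∀ i < n, wordDist A (g i) (g (i + 1)) = 1) →
    ∀ i ≤ n, ∃ z ∈ H, wordDist A (g i) z ≤ q

end Defs

section WordMetric

variable {G : Type*} [Group G] {A : Set G}

theorem exists_word_length_eq (hA : Subgroup.closure A = ⊤) (g : G) :
    ∃ w : List G, w.length = wordLength A g ∧ (∀ x ∈ w, x ∈ A ∨ x⁻¹ ∈ A) ∧ w.prod = g := by
  have hg : g ∈ Submonoid.closure (A ∪ A⁻¹) := by
    rw [← Subgroup.closure_toSubmonoid, hA]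
    exact Subgroup.mem_top g
  obtain ⟨w, hw, hprod⟩ := Submonoid.exists_list_of_mem_closure hg
  exact Nat.sInf_mem (s := {n : ℕ | ∃ w : List G, w.length = n ∧
    (∀ x ∈ w, x ∈ A ∨ x⁻¹ ∈ A) ∧ w.prod = g}) ⟨w.length, w, rfl, hw, hprod⟩

theorem wordLength_mul_le (hA : Subgroup.closure A = ⊤) (g h : G) :
    wordLength A (g * h) ≤ wordLength A g + wordLength A h := by
  obtain ⟨u, hu, hu', rfl⟩ := exists_word_length_eq hA g
  obtain ⟨v, hv, hv', rfl⟩ := exists_word_length_eq hA h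
  rw [← hu, ← hv, ← List.prod_append, ← List.length_append]
  refine Nat.sInf_le ⟨u ++ v, rfl, fun x hx => ?_, rfl⟩
  exact (List.mem_append.mp hx).elim (hu' x) (hv' x)

theorem wordDist_triangle (hA : Subgroup.closure A = ⊤) (g h k : G) :
    wordDist A g k ≤ wordDist A g h + wordDist A h k := by
  have := wordLength_mul_le hA (g⁻¹ * h) (h⁻¹ * k)
  rw [show g⁻¹ * h * (h⁻¹ * k) = g⁻¹ * k by group] at this
  unfold wordDist
  exact_mod_cast this

theorem wordDist_mul_left (a g h : G) : wordDist A (a * g) (a * h) = wordDist A g h := by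
  unfold wordDist
  congr 2
  group

theorem gromov_conj_ge (hA : Subgroup.closure A = ⊤) (p x g h : G) :
    gromov (wordDist A) p g h -
        (wordDist A p (x * p) + wordDist A x 1 + (wordDist A x 1 + wordDist A 1 x) / 2) ≤
      gromov (wordDist A) p (x⁻¹ * g * x) (x⁻¹ * h * x) := by
  have base (k : G) : wordDist A p (x⁻¹ * k * x) = wordDist A (x * p) (k * x) := by
    rw [← wordDist_mul_left x]
    congr 1
    group
  have conj : wordDist A (x⁻¹ * g * x) (x⁻¹ * h * x) = wordDist A (g * x) (h * x) := by
    rw [mul_assoc, mul_assoc, wordDist_mul_left]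
  have right (k : G) : wordDist A (k * x) k = wordDist A x 1 := by
    simpa using wordDist_mul_left (A := A) k x 1
  have left (k : G) : wordDist A k (k * x) = wordDist A 1 x := by
    simpa using wordDist_mul_left (A := A) k 1 x
  have far (k : G) : wordDist A p k ≤
      wordDist A p (x * p) + wordDist A (x * p) (k * x) + wordDist A x 1 := by
    linarith [wordDist_triangle hA p (x * p) k, wordDist_triangle hA (x * p) (k * x) k, right k]
  have near : wordDist A (g * x) (h * x) ≤
      wordDist A x 1 + wordDist A g h + wordDist A 1 x := by
    linarith [wordDist_triangle hA (g * x) g (h * x), wordDist_triangle hA g h (h * x),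
      right g, left h]
  unfold gromov
  rw [base, base, conj]
  linarith [far g, far h]

end WordMetric

theorem lipschitzCond_of_gromov_ge {X : Type*} {dA : X → X → ℝ} {p : X} {γ T : ℝ} (hγ : 0 ≤ γ)
    (hT : 0 < T) {d : X → X → ℝ} (hd : InVisualOf dA p γ T d) {φ : X → X}
    (hφ : Function.Injective φ) {C : ℝ}
    (hC : ∀ g h, gromov dA p g h - C ≤ gromov dA p (φ g) (φ h)) :
    LipschitzCond d d φ := by
  refine ⟨T * T * Real.exp (γ * C), by positivity, fun g h => ?_⟩
  rcases eq_or_ne g h with rfl | hgh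
  · simp [hd.1.refl]
  have lower := (hd.2 g h hgh).1
  have upper := (hd.2 (φ g) (φ h) (hφ.ne hgh)).2
  rw [visualRhoOf, if_neg hgh, div_le_iff₀ hT] at lower
  rw [visualRhoOf, if_neg (hφ.ne hgh)] at upper
  calc d (φ g) (φ h) ≤ T * Real.exp (-γ * gromov dA p (φ g) (φ h)) := upper
    _ ≤ T * Real.exp (γ * C + -γ * gromov dA p g h) := by
      gcongr
      nlinarith [mul_le_mul_of_nonneg_left (hC g h) hγ]
    _ = T * Real.exp (γ * C) * Real.exp (-γ * gromov dA p g h) := by rw [Real.exp_add]; ring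
    _ ≤ T * Real.exp (γ * C) * (d g h * T) := by gcongr
    _ = T * T * Real.exp (γ * C) * d g h := by ring

/-- Every inner automorphism `g ↦ x⁻¹gx` of a hyperbolic group
satisfies a Lipschitz condition with respect to any visual metric. -/
theorem stmt_12 {G : Type*} [Group G] (A : Set G)
    (hAfin : A.Finite) (hAgen : Subgroup.closure A = ⊤) (hhyp : IsHyperbolic A)
    (p : G) (γ T : ℝ) (hγ : 0 < γ) (hT : 1 ≤ T)
    (d : G → G → ℝ) (hd : InVisual A p γ T d) (x : G) :
    LipschitzCond d d (fun g => x⁻¹ * g * x) :=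
  lipschitzCond_of_gromov_ge hγ.le (by linarith) hd
    (fun g h hgh => mul_left_cancel (mul_right_cancel hgh)) (gromov_conj_ge hAgen p x)
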